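/- Suppose the rate pair (R₁₂, 0) is admissible for q with r = 1 round of communication (a single message from node 1 to node 2). Then there exists a pmf p(u, x¹, x², y¹, y²) on 𝒰×𝒳¹×𝒳²×𝒴¹×𝒴² whose (x¹,x²,y¹,y²)-marginal equals q, satisfying the Markov chains U – X¹ – X², Y¹ – (U,X¹) – (X²,Y²), and Y² – (U,X²) – (X¹,Y¹), with |𝒰| ≤ |𝒳¹||𝒴¹||𝒳²||𝒴²| + 1, such that R₁₂ ≥ I_p(U; X¹,Y¹,Y² | X²). -/

import Mathlib

open scoped BigOperators
open Finset

noncomputable section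

namespace Coord

variable {Ω α β γ : Type*}

/-- `p` is a probability mass function on the finite type `α`. -/
def IsPMF [Fintype α] (p : α → ℝ) : Prop := (∀ a, 0 ≤ p a) ∧ ∑ a, p a = 1

/-- ℓ¹ (total variation) distance between two functions on a finite type. -/
def l1dist [Fintype α] (p q : α → ℝ) : ℝ := ∑ a, |p a - q a|

/-- The distribution (pushforward pmf) of the random variable `X` defined on the
finite sample space `Ω` carrying the pmf `μ`. -/
def distr [Fintype Ω] [DecidableEq α] (μ : Ω → ℝ) (X : Ω → α) : α → ℝ :=
  fun a => ∑ ω, if X ω = a then μ ω else 0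

/-- Shannon entropy (base 2) of a pmf. -/
def entFun [Fintype α] (p : α → ℝ) : ℝ := - ∑ a, p a * Real.logb 2 (p a)

/-- Shannon entropy `H(X)` of a random variable `X` on `(Ω, μ)`. -/
def H [Fintype Ω] [Fintype α] [DecidableEq α] (μ : Ω → ℝ) (X : Ω → α) : ℝ :=
  entFun (distr μ X)

/-- Conditional entropy `H(X | Z)`. -/
def condEnt [Fintype Ω] [Fintype α] [Fintype γ] [DecidableEq α] [DecidableEq γ]
    (μ : Ω → ℝ) (X : Ω → α) (Z : Ω → γ) : ℝ :=
  H μ (fun ω => (X ω, Z ω)) - H μ Z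

/-- Mutual information `I(X; Y)`. -/
def mi [Fintype Ω] [Fintype α] [Fintype β] [DecidableEq α] [DecidableEq β]
    (μ : Ω → ℝ) (X : Ω → α) (Y : Ω → β) : ℝ :=
  H μ X + H μ Y - H μ (fun ω => (X ω, Y ω))

/-- Conditional mutual information `I(X; Y | Z)`. -/
def cmi [Fintype Ω] [Fintype α] [Fintype β] [Fintype γ]
    [DecidableEq α] [DecidableEq β] [DecidableEq γ]
    (μ : Ω → ℝ) (X : Ω → α) (Y : Ω → β) (Z : Ω → γ) : ℝ :=
  H μ (fun ω => (X ω, Z ω)) + H μ (fun ω => (Y ω, Z ω))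
    - H μ (fun ω => (X ω, Y ω, Z ω)) - H μ Z

variable {𝒳₁ 𝒳₂ 𝒴₁ 𝒴₂ : Type}

/-- The `(x¹, x²)`-marginal of `q(x¹, x², y¹, y²)`. -/
def srcMarg [Fintype 𝒴₁] [Fintype 𝒴₂] (q : 𝒳₁ × 𝒳₂ × 𝒴₁ × 𝒴₂ → ℝ) :
    𝒳₁ × 𝒳₂ → ℝ := fun x => ∑ y₁, ∑ y₂, q (x.1, x.2, y₁, y₂)

/-- The rate pair `(R12, R21)` is admissible for the coordination problem `q` with `r`
interactive rounds of communication: for every `ε > 0`, for all large enough block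
lengths `n`, there is a finite probability space carrying the i.i.d. sources, private
randomness `M₁, M₂`, interactive messages `C i` (messages with even Lean-index,
i.e. odd 1-based index, are sent by the first node), and outputs `Y₁, Y₂`,
meeting the rate constraints and approximating the i.i.d. target distribution
within total variation `ε`. -/
def Admissible [Fintype 𝒳₁] [Fintype 𝒳₂] [Fintype 𝒴₁] [Fintype 𝒴₂]
    [DecidableEq 𝒳₁] [DecidableEq 𝒳₂] [DecidableEq 𝒴₁] [DecidableEq 𝒴₂]
    (q : 𝒳₁ × 𝒳₂ × 𝒴₁ × 𝒴₂ → ℝ) (r : ℕ) (R12 R21 : ℝ) : Prop :=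
  ∀ ε : ℝ, 0 < ε → ∃ n₀ : ℕ, ∀ n : ℕ, n₀ ≤ n →
    ∃ (Ω 𝓜₁ 𝓜₂ : Type) (𝓒 : Fin r → Type)
      (_ : Fintype Ω) (_ : DecidableEq Ω)
      (_ : Fintype 𝓜₁) (_ : DecidableEq 𝓜₁)
      (_ : Fintype 𝓜₂) (_ : DecidableEq 𝓜₂)
      (_ : ∀ i, Fintype (𝓒 i)) (_ : ∀ i, DecidableEq (𝓒 i))
      (μ : Ω → ℝ)
      (X₁ : Ω → Fin n → 𝒳₁) (X₂ : Ω → Fin n → 𝒳₂)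
      (M₁ : Ω → 𝓜₁) (M₂ : Ω → 𝓜₂)
      (C : (i : Fin r) → Ω → 𝓒 i)
      (Y₁ : Ω → Fin n → 𝒴₁) (Y₂ : Ω → Fin n → 𝒴₂),
      IsPMF μ ∧
      -- the source pairs are i.i.d. with per-letter distribution the (x¹,x²)-marginal of q
      (distr μ (fun ω => (X₁ ω, X₂ ω)) =
        fun x => ∏ k, srcMarg q (x.1 k, x.2 k)) ∧
      -- M₁, M₂ and the sources are mutually independent
      (distr μ (fun ω => (M₁ ω, M₂ ω, X₁ ω, X₂ ω)) =
        fun m => distr μ M₁ m.1 * distr μ M₂ m.2.1 *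
          distr μ (fun ω => (X₁ ω, X₂ ω)) m.2.2) ∧
      -- messages with odd 1-based index are functions of (previous messages, X¹, M₁)
      (∀ i : Fin r, (i : ℕ) % 2 = 0 →
        condEnt μ (C i)
          (fun ω => ((fun j : Fin (i : ℕ) => C ⟨j.1, j.2.trans i.2⟩ ω), X₁ ω, M₁ ω)) = 0) ∧
      -- messages with even 1-based index are functions of (previous messages, X², M₂)
      (∀ i : Fin r, (i : ℕ) % 2 = 1 →
        condEnt μ (C i)
          (fun ω => ((fun j : Fin (i : ℕ) => C ⟨j.1, j.2.trans i.2⟩ ω), X₂ ω, M₂ ω)) = 0) ∧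
      -- rate constraints
      (∑ i ∈ Finset.univ.filter (fun i : Fin r => (i : ℕ) % 2 = 0), H μ (C i)) ≤ n * R12 ∧
      (∑ i ∈ Finset.univ.filter (fun i : Fin r => (i : ℕ) % 2 = 1), H μ (C i)) ≤ n * R21 ∧
      -- the outputs are produced from the locally available information
      condEnt μ Y₁ (fun ω => (X₁ ω, M₁ ω, fun i : Fin r => C i ω)) = 0 ∧
      condEnt μ Y₂ (fun ω => (X₂ ω, M₂ ω, fun i : Fin r => C i ω)) = 0 ∧
      -- total variation distance to the i.i.d. target is at most ε
      l1dist (distr μ (fun ω => (X₁ ω, X₂ ω, Y₁ ω, Y₂ ω)))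
        (fun a => ∏ k, q (a.1 k, a.2.1 k, a.2.2.1 k, a.2.2.2 k)) ≤ ε

/-- Entropy in nats of a nonnegative function on a finite type. -/
def natEnt [Fintype α] (p : α → ℝ) : ℝ := ∑ a, Real.negMulLog (p a)

lemma entFun_eq_natEnt_div [Fintype α] (p : α → ℝ) : entFun p = natEnt p / Real.log 2 := by
  simp only [entFun, natEnt, Real.negMulLog, Real.logb, Finset.sum_div, ← Finset.sum_neg_distrib]
  exact Finset.sum_congr rfl fun _ _ => by ring

lemma IsPMF.le_one [Fintype α] {p : α → ℝ} (hp : IsPMF p) (a : α) : p a ≤ 1 :=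
  hp.2 ▸ Finset.single_le_sum (fun i _ => hp.1 i) (Finset.mem_univ a)

lemma natEnt_comp_equiv [Fintype α] [Fintype β] (e : α ≃ β) (p : β → ℝ) :
    natEnt (fun a => p (e a)) = natEnt p :=
  Fintype.sum_equiv e _ _ fun _ => rfl

section Distr

variable [Fintype Ω] [DecidableEq α] [DecidableEq β]

lemma distr_nonneg {μ : Ω → ℝ} (hμ : ∀ ω, 0 ≤ μ ω) (X : Ω → α) (a : α) : 0 ≤ distr μ X a :=
  Finset.sum_nonneg fun ω _ => by split_ifs <;> simp [hμ]

lemma sum_distr_mul [Fintype α] (μ : Ω → ℝ) (X : Ω → α) (f : α → ℝ) :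
    ∑ a, distr μ X a * f a = ∑ ω, μ ω * f (X ω) := by
  simp only [distr, Finset.sum_mul, ite_mul, zero_mul]
  rw [Finset.sum_comm]
  simp

lemma sum_distr [Fintype α] (μ : Ω → ℝ) (X : Ω → α) : ∑ a, distr μ X a = ∑ ω, μ ω := by
  simpa using sum_distr_mul μ X fun _ => 1

lemma IsPMF.distr [Fintype α] {μ : Ω → ℝ} (hμ : IsPMF μ) (X : Ω → α) :
    IsPMF (Coord.distr μ X) :=
  ⟨distr_nonneg hμ.1 X, (sum_distr μ X).trans hμ.2⟩

lemma le_distr_apply {μ : Ω → ℝ} (hμ : ∀ ω, 0 ≤ μ ω) (X : Ω → α) (ω : Ω) :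
    μ ω ≤ distr μ X (X ω) := by
  have := Finset.single_le_sum (f := fun ω' => if X ω' = X ω then μ ω' else 0)
    (fun i _ => by split_ifs <;> simp [hμ]) (Finset.mem_univ ω)
  simpa [distr] using this

lemma distr_distr [Fintype α] (μ : Ω → ℝ) (X : Ω → α) (g : α → β) :
    distr (distr μ X) g = distr μ (fun ω => g (X ω)) := by
  funext b
  have := sum_distr_mul μ X fun a => if g a = b then (1 : ℝ) else 0
  simpa [distr] using this

lemma distr_congr {μ : Ω → ℝ} {X Y : Ω → α} (h : ∀ ω, μ ω ≠ 0 → X ω = Y ω) :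
    distr μ X = distr μ Y := by
  funext a
  refine Finset.sum_congr rfl fun ω _ => ?_
  by_cases hω : μ ω = 0
  · simp [hω]
  · rw [h ω hω]

lemma distr_apply_le_comp [Fintype α] {μ : Ω → ℝ} (hμ : ∀ ω, 0 ≤ μ ω) (X : Ω → α) (g : α → β)
    (a : α) : distr μ X a ≤ distr μ (fun ω => g (X ω)) (g a) := by
  rw [← distr_distr μ X g]
  exact le_distr_apply (distr_nonneg hμ X) g a

lemma distr_comp_injective (μ : Ω → ℝ) (X : Ω → α) {g : α → β} (hg : Function.Injective g)
    (a : α) : distr μ (fun ω => g (X ω)) (g a) = distr μ X a := by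
  simp [distr, hg.eq_iff]

lemma sum_distr_pair [Fintype α] (μ : Ω → ℝ) (X : Ω → α) (Y : Ω → β) (b : β) :
    ∑ a, distr μ (fun ω => (X ω, Y ω)) (a, b) = distr μ Y b := by
  simp only [distr, Prod.mk.injEq]
  rw [Finset.sum_comm]
  refine Finset.sum_congr rfl fun ω _ => ?_
  by_cases h : Y ω = b <;> simp [h]

lemma natEnt_distr [Fintype α] (μ : Ω → ℝ) (X : Ω → α) :
    natEnt (distr μ X) = ∑ ω, μ ω * -Real.log (distr μ X (X ω)) := by
  rw [← sum_distr_mul μ X fun a => -Real.log (distr μ X a)]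
  exact Finset.sum_congr rfl fun a _ => by simp [Real.negMulLog]

/-- Gibbs' inequality. -/
lemma natEnt_distr_le [Fintype α] {μ : Ω → ℝ} (hμ : IsPMF μ) (X : Ω → α) (g : α → ℝ)
    (hg : ∀ a, 0 ≤ g a) (hg1 : ∑ a, g a ≤ 1) (hpos : ∀ ω, μ ω ≠ 0 → 0 < g (X ω)) :
    natEnt (distr μ X) ≤ ∑ ω, μ ω * -Real.log (g (X ω)) := by
  rw [← sum_distr_mul μ X fun a => -Real.log (g a), ← sub_nonpos, natEnt,
    ← Finset.sum_sub_distrib]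
  have hP := hμ.distr X
  refine (Finset.sum_le_sum (g := fun a => g a - distr μ X a) fun a _ => ?_).trans ?_
  · rcases (hP.1 a).eq_or_lt with h | h
    · simp [← h, hg a]
    · have hga : 0 < g a := by
        obtain ⟨ω, -, hω⟩ := Finset.exists_ne_zero_of_sum_ne_zero h.ne'
        split_ifs at hω with hX
        · exact hX ▸ hpos ω hω
        · exact absurd rfl hω
      have := mul_le_mul_of_nonneg_left (Real.log_le_sub_one_of_pos (div_pos hga h)) h.le
      rw [Real.log_div hga.ne' h.ne', mul_sub, mul_sub, mul_div_cancel₀ _ h.ne'] at this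
      simp only [Real.negMulLog]
      linarith
  · rw [Finset.sum_sub_distrib, hP.2]
    linarith

lemma natEnt_comp_le [Fintype α] [Fintype β] {μ : Ω → ℝ} (hμ : ∀ ω, 0 ≤ μ ω) (X : Ω → α)
    (g : α → β) : natEnt (distr μ fun ω => g (X ω)) ≤ natEnt (distr μ X) := by
  rw [natEnt_distr, natEnt_distr]
  refine Finset.sum_le_sum fun ω _ => ?_
  rcases (hμ ω).eq_or_lt with h | h
  · simp [← h]
  · refine mul_le_mul_of_nonneg_left (neg_le_neg (Real.log_le_log ?_ ?_)) h.le
    · exact h.trans_le (le_distr_apply hμ X ω)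
    · exact distr_apply_le_comp hμ X g (X ω)

lemma natEnt_comp_injective [Fintype α] [Fintype β] (μ : Ω → ℝ) (X : Ω → α) {g : α → β}
    (hg : Function.Injective g) :
    natEnt (distr μ fun ω => g (X ω)) = natEnt (distr μ X) := by
  rw [natEnt_distr, natEnt_distr]
  simp only [distr_comp_injective μ X hg]

lemma natEnt_pair_le [Fintype α] [Fintype β] {μ : Ω → ℝ} (hμ : IsPMF μ) (X : Ω → α)
    (Y : Ω → β) :
    natEnt (distr μ fun ω => (X ω, Y ω)) ≤ natEnt (distr μ X) + natEnt (distr μ Y) := by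
  have hX := hμ.distr X
  have hY := hμ.distr Y
  have hpos : ∀ ω, μ ω ≠ 0 → 0 < distr μ X (X ω) ∧ 0 < distr μ Y (Y ω) := fun ω hω =>
    have h := (hμ.1 ω).lt_of_ne' hω
    ⟨h.trans_le (le_distr_apply hμ.1 X ω), h.trans_le (le_distr_apply hμ.1 Y ω)⟩
  refine (natEnt_distr_le hμ _ (fun a : α × β => distr μ X a.1 * distr μ Y a.2)
    (fun a => mul_nonneg (hX.1 _) (hY.1 _)) ?_ fun ω hω => ?_).trans (le_of_eq ?_)
  · simp [Fintype.sum_prod_type, ← Finset.mul_sum, hX.2, hY.2]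
  · exact mul_pos (hpos ω hω).1 (hpos ω hω).2
  · rw [natEnt_distr, natEnt_distr, ← Finset.sum_add_distrib]
    refine Finset.sum_congr rfl fun ω _ => ?_
    by_cases h : μ ω = 0
    · simp [h]
    · rw [Real.log_mul (hpos ω h).1.ne' (hpos ω h).2.ne']
      ring

/-- Conditional subadditivity of entropy. -/
lemma natEnt_pi_pair_le [Fintype α] [Fintype β] {μ : Ω → ℝ} (hμ : IsPMF μ) {n : ℕ}
    (A : Fin n → Ω → α) (W : Ω → β) :
    natEnt (distr μ fun ω => ((fun k => A k ω), W ω)) ≤ natEnt (distr μ W) +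
      ∑ k, (natEnt (distr μ fun ω => (A k ω, W ω)) - natEnt (distr μ W)) := by
  have hW := hμ.distr W
  have hA := fun k => hμ.distr fun ω => (A k ω, W ω)
  have hposW : ∀ ω, μ ω ≠ 0 → 0 < distr μ W (W ω) := fun ω hω =>
    ((hμ.1 ω).lt_of_ne' hω).trans_le (le_distr_apply hμ.1 W ω)
  have hposA : ∀ k ω, μ ω ≠ 0 → 0 < distr μ (fun ω => (A k ω, W ω)) (A k ω, W ω) :=
    fun k ω hω => ((hμ.1 ω).lt_of_ne' hω).trans_le
      (le_distr_apply hμ.1 (fun ω => (A k ω, W ω)) ω)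
  refine (natEnt_distr_le hμ _ (fun a : (Fin n → α) × β => distr μ W a.2 *
    ∏ k, (distr μ (fun ω => (A k ω, W ω)) (a.1 k, a.2) / distr μ W a.2))
    (fun a => mul_nonneg (hW.1 _) (Finset.prod_nonneg fun k _ => div_nonneg ((hA k).1 _) (hW.1 _)))
    ?_ fun ω hω => ?_).trans (le_of_eq ?_)
  · rw [Fintype.sum_prod_type_right, ← hW.2]
    refine Finset.sum_le_sum fun w _ => ?_
    dsimp only
    rw [← Finset.mul_sum]
    rcases (hW.1 w).eq_or_lt with h | h
    · simp [← h]
    · have := Finset.prod_univ_sum (fun _ : Fin n => (Finset.univ : Finset α))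
        fun k a => distr μ (fun ω => (A k ω, W ω)) (a, w) / distr μ W w
      rw [Fintype.piFinset_univ] at this
      rw [← this]
      simp [← Finset.sum_div, sum_distr_pair, h.ne']
  · exact mul_pos (hposW ω hω) (Finset.prod_pos fun k _ => div_pos (hposA k ω hω) (hposW ω hω))
  · simp only [natEnt_distr, ← Finset.sum_sub_distrib]
    rw [Finset.sum_comm, ← Finset.sum_add_distrib]
    refine Finset.sum_congr rfl fun ω _ => ?_
    by_cases h : μ ω = 0
    · simp [h]
    · rw [Real.log_mul (hposW ω h).ne'
        (Finset.prod_pos fun k _ => div_pos (hposA k ω h) (hposW ω h)).ne',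
        Real.log_prod (fun k _ => (div_pos (hposA k ω h) (hposW ω h)).ne'), neg_add, mul_add,
        ← Finset.sum_neg_distrib, Finset.mul_sum]
      congr 1
      refine Finset.sum_congr rfl fun k _ => ?_
      rw [Real.log_div (hposA k ω h).ne' (hposW ω h).ne']
      ring

/-- If `H(X | Z) = 0`, then `X` is almost surely a function of `Z`. -/
lemma exists_eq_comp_of_condEnt_eq_zero [Fintype α] [Fintype β] {μ : Ω → ℝ} (hμ : IsPMF μ)
    (X : Ω → α) (Z : Ω → β) (h : condEnt μ X Z = 0) :
    ∃ f : β → α, ∀ ω, μ ω ≠ 0 → X ω = f (Z ω) := by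
  have hlog : (0 : ℝ) < Real.log 2 := Real.log_pos one_lt_two
  have h1 : ∑ ω, μ ω * (Real.log (distr μ Z (Z ω)) -
      Real.log (distr μ (fun ω => (X ω, Z ω)) (X ω, Z ω))) = 0 := by
    simp only [condEnt, H, entFun_eq_natEnt_div, ← sub_div, div_eq_zero_iff, hlog.ne', or_false,
      natEnt_distr, ← Finset.sum_sub_distrib] at h
    rw [← h]
    exact Finset.sum_congr rfl fun ω _ => by ring
  have hle : ∀ ω, distr μ (fun ω => (X ω, Z ω)) (X ω, Z ω) ≤ distr μ Z (Z ω) := fun ω =>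
    distr_apply_le_comp hμ.1 (fun ω => (X ω, Z ω)) Prod.snd (X ω, Z ω)
  have hpos : ∀ ω, μ ω ≠ 0 → 0 < distr μ (fun ω => (X ω, Z ω)) (X ω, Z ω) := fun ω hω =>
    ((hμ.1 ω).lt_of_ne' hω).trans_le (le_distr_apply hμ.1 (fun ω => (X ω, Z ω)) ω)
  rw [Finset.sum_eq_zero_iff_of_nonneg] at h1
  · have heq : ∀ ω, μ ω ≠ 0 →
        distr μ (fun ω => (X ω, Z ω)) (X ω, Z ω) = distr μ Z (Z ω) := fun ω hω => by
      have := (mul_eq_zero.1 (h1 ω (Finset.mem_univ ω))).resolve_left hω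
      exact (Real.log_injOn_pos (hpos ω hω) ((hpos ω hω).trans_le (hle ω))
        (sub_eq_zero.1 this).symm)
    have hdet : ∀ ω ω', μ ω ≠ 0 → μ ω' ≠ 0 → Z ω' = Z ω → X ω' = X ω := by
      intro ω ω' hω hω' hZ
      by_contra hX
      have h0 := heq ω hω
      simp only [distr, Prod.mk.injEq] at h0
      rw [← sub_eq_zero, ← Finset.sum_sub_distrib, ← neg_eq_zero, ← Finset.sum_neg_distrib,
        Finset.sum_eq_zero_iff_of_nonneg] at h0
      · have := h0 ω' (Finset.mem_univ _)
        simp [hX, hZ, hω'] at this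
      · intro ω'' _
        by_cases h1 : X ω'' = X ω <;> by_cases h2 : Z ω'' = Z ω <;> simp [h1, h2, hμ.1]
    obtain ⟨ω₀, -, -⟩ := Finset.exists_ne_zero_of_sum_ne_zero (hμ.2.trans_ne one_ne_zero)
    classical
    refine ⟨fun z => if h : ∃ ω, μ ω ≠ 0 ∧ Z ω = z then X h.choose else X ω₀, fun ω hω => ?_⟩
    have hex : ∃ ω', μ ω' ≠ 0 ∧ Z ω' = Z ω := ⟨ω, hω, rfl⟩
    simp only [dif_pos hex]
    exact (hdet ω _ hω hex.choose_spec.1 hex.choose_spec.2).symm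
  · intro ω _
    by_cases hω : μ ω = 0
    · simp [hω]
    · exact mul_nonneg (hμ.1 ω) (sub_nonneg.2 (Real.log_le_log (hpos ω hω) (hle ω)))

end Distr

lemma l1dist_distr_le [Fintype α] [Fintype β] [DecidableEq β] (p q : α → ℝ) (g : α → β) :
    l1dist (distr p g) (distr q g) ≤ l1dist p q := by
  have h : ∀ b, |distr p g b - distr q g b| ≤ distr (fun a => |p a - q a|) g b := by
    intro b
    simp only [distr, ← Finset.sum_sub_distrib]
    refine (Finset.abs_sum_le_sum_abs _ _).trans (Finset.sum_le_sum fun a _ => ?_)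
    split_ifs <;> simp
  exact (Finset.sum_le_sum fun b _ => h b).trans (sum_distr _ g).le

section Product

variable [Fintype α]

lemma IsPMF.pi_prod {p : α → ℝ} (hp : IsPMF p) (n : ℕ) :
    IsPMF fun a : Fin n → α => ∏ k, p (a k) := by
  classical
  refine ⟨fun a => Finset.prod_nonneg fun k _ => hp.1 _, ?_⟩
  have := Finset.prod_univ_sum (fun _ : Fin n => (Finset.univ : Finset α)) fun _ a => p a
  rw [Fintype.piFinset_univ] at this
  rw [← this]
  simp [hp.2]

lemma natEnt_pi_prod {p : α → ℝ} (hp : IsPMF p) (n : ℕ) :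
    natEnt (fun a : Fin n → α => ∏ k, p (a k)) = n * natEnt p := by
  induction n with
  | zero => simp [natEnt]
  | succ n ih =>
    rw [← natEnt_comp_equiv (Fin.consEquiv fun _ : Fin (n + 1) => α)]
    have h1 := (hp.pi_prod n).2
    simp only [natEnt] at ih ⊢
    simp only [Fin.consEquiv, Equiv.coe_fn_mk, Fin.prod_univ_succ, Fin.cons_zero, Fin.cons_succ,
      Real.negMulLog_mul, Fintype.sum_prod_type, Finset.sum_add_distrib, ← Finset.mul_sum,
      ← Finset.sum_mul, h1, hp.2, ih]
    push_cast
    ring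

lemma distr_pi_prod_apply [DecidableEq α] {p : α → ℝ} (hp : IsPMF p) {n : ℕ} (k : Fin n) :
    distr (fun a : Fin n → α => ∏ j, p (a j)) (fun a => a k) = p := by
  funext b
  have h : ∀ a : Fin n → α, (if a k = b then ∏ j, p (a j) else 0) =
      ∏ j, if j = k then (if a j = b then p (a j) else 0) else p (a j) := by
    intro a
    split_ifs with hb
    · refine Finset.prod_congr rfl fun j _ => ?_
      split_ifs with h1 h2
      · rfl
      · exact absurd (h1 ▸ hb) h2
      · rfl
    · exact (Finset.prod_eq_zero (Finset.mem_univ k) (by simp [hb])).symm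
  simp only [distr, h]
  have := Finset.prod_univ_sum (fun _ : Fin n => (Finset.univ : Finset α))
    fun j a => if j = k then (if a = b then p a else 0) else p a
  rw [Fintype.piFinset_univ] at this
  rw [← this]
  have h2 : ∀ j : Fin n, ∑ a, (if j = k then (if a = b then p a else 0) else p a) =
      if j = k then p b else 1 := by
    intro j
    split_ifs <;> simp [hp.2]
  simp [h2]

end Product

lemma negMulLog_add_le {x y : ℝ} (hx : 0 ≤ x) (hy : 0 ≤ y) :
    Real.negMulLog (x + y) ≤ Real.negMulLog x + Real.negMulLog y := by
  rcases hx.eq_or_lt with rfl | hx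
  · simp
  rcases hy.eq_or_lt with rfl | hy
  · simp
  have h1 := mul_le_mul_of_nonneg_left (Real.log_le_log hx (by linarith : x ≤ x + y)) hx.le
  have h2 := mul_le_mul_of_nonneg_left (Real.log_le_log hy (by linarith : y ≤ x + y)) hy.le
  simp only [Real.negMulLog]
  linarith

lemma negMulLog_le_add_sub {x y : ℝ} (hx : 0 ≤ x) (hxy : x ≤ y) (hy : y ≤ 1) :
    Real.negMulLog x ≤ Real.negMulLog y + (y - x) := by
  rcases hx.eq_or_lt with rfl | hx
  · simpa using add_nonneg (Real.negMulLog_nonneg hxy hy) hxy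
  have hy0 := hx.trans_le hxy
  have h1 := Real.log_le_sub_one_of_pos (div_pos hy0 hx)
  rw [Real.log_div hy0.ne' hx.ne'] at h1
  have h2 := mul_le_mul_of_nonneg_left h1 hx.le
  rw [mul_sub x (y / x), mul_div_cancel₀ _ hx.ne'] at h2
  have h3 := mul_nonneg (sub_nonneg.2 hxy) (neg_nonneg.2 (Real.log_nonpos hy0.le hy))
  simp only [Real.negMulLog]
  linarith

/-- A Fannes-type continuity bound for the entropy. -/
lemma natEnt_le_add_l1dist [Fintype α] {p q : α → ℝ} (hp : IsPMF p) (hq : IsPMF q) :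
    natEnt q ≤ natEnt p + l1dist p q * Real.log (Fintype.card α) + 1 := by
  have hpt : ∀ a, Real.negMulLog (q a) ≤
      Real.negMulLog (p a) + Real.negMulLog |p a - q a| + |p a - q a| := by
    intro a
    rcases le_total (p a) (q a) with h | h
    · have := negMulLog_add_le (hp.1 a) (sub_nonneg.2 h)
      rw [add_sub_cancel] at this
      rw [abs_sub_comm, abs_of_nonneg (sub_nonneg.2 h)]
      linarith
    · have h1 := negMulLog_le_add_sub (hq.1 a) h (hp.le_one a)
      have h2 := Real.negMulLog_nonneg (sub_nonneg.2 h)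
        ((sub_le_self _ (hq.1 a)).trans (hp.le_one a))
      rw [abs_of_nonneg (sub_nonneg.2 h)]
      linarith
  have hN : 0 < Fintype.card α := by
    obtain ⟨a, -, -⟩ := Finset.exists_ne_zero_of_sum_ne_zero (hp.2.trans_ne one_ne_zero)
    exact Fintype.card_pos_iff.2 ⟨a⟩
  have hN' : (0 : ℝ) < Fintype.card α := by exact_mod_cast hN
  have hJ := Real.concaveOn_negMulLog.le_map_sum (t := Finset.univ)
    (w := fun _ : α => (Fintype.card α : ℝ)⁻¹) (p := fun a => |p a - q a|)
    (fun _ _ => inv_nonneg.2 hN'.le) (by simp [hN'.ne']) fun a _ => Set.mem_Ici.2 (abs_nonneg _)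
  simp only [smul_eq_mul, ← Finset.mul_sum] at hJ
  have hD : ∑ a, |p a - q a| = l1dist p q := rfl
  rw [hD, Real.negMulLog_mul] at hJ
  have hD0 : 0 ≤ l1dist p q := Finset.sum_nonneg fun _ _ => abs_nonneg _
  have hJ2 := mul_le_mul_of_nonneg_left hJ hN'.le
  have e1 : Real.negMulLog (Fintype.card α : ℝ)⁻¹ =
      (Fintype.card α : ℝ)⁻¹ * Real.log (Fintype.card α) := by
    simp [Real.negMulLog]
  rw [e1, mul_inv_cancel_left₀ hN'.ne', mul_add, mul_inv_cancel_left₀ hN'.ne',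
    mul_left_comm, mul_inv_cancel_left₀ hN'.ne'] at hJ2
  have h3 := Real.negMulLog_le_one_sub_self hD0
  have h4 := Finset.sum_le_sum fun a (_ : a ∈ Finset.univ) => hpt a
  simp only [Finset.sum_add_distrib] at h4
  simp only [natEnt]
  linarith

/-- In a finite-dimensional space the convex hull of a compact set is compact. -/
lemma isCompact_convexHull {E : Type*} [AddCommGroup E] [Module ℝ E] [FiniteDimensional ℝ E]
    [TopologicalSpace E] [ContinuousAdd E] [ContinuousSMul ℝ E] {s : Set E}
    (hs : IsCompact s) : IsCompact (convexHull ℝ s) := by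
  rcases s.eq_empty_or_nonempty with rfl | ⟨z₀, hz₀⟩
  · simp
  set N := Module.finrank ℝ E + 1 with hN
  have hK : IsCompact (stdSimplex ℝ (Fin N) ×ˢ Set.univ.pi fun _ : Fin N => s) :=
    (isCompact_stdSimplex ℝ (Fin N)).prod (isCompact_univ_pi fun _ => hs)
  convert hK.image (f := fun a : (Fin N → ℝ) × (Fin N → E) => ∑ i, a.1 i • a.2 i)
    (by fun_prop) using 1
  refine Set.Subset.antisymm (fun x hx => ?_) ?_
  · obtain ⟨ι, hι, z, w, hz, hind, hw, hw1, rfl⟩ := eq_pos_convex_span_of_mem_convexHull hx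
    have hcard : Fintype.card ι ≤ Fintype.card (Fin N) := by
      rw [Fintype.card_fin]
      exact hind.card_le_finrank_succ.trans (Nat.succ_le_succ (Submodule.finrank_le _))
    obtain ⟨e⟩ := Function.Embedding.nonempty_of_card_le hcard
    refine ⟨(Function.extend e w 0, Function.extend e z fun _ => z₀), ⟨⟨fun i => ?_, ?_⟩, ?_⟩, ?_⟩
    · by_cases hi : ∃ j, e j = i
      · obtain ⟨j, rfl⟩ := hi
        simpa [e.injective.extend_apply] using (hw j).le
      · simp [Function.extend_apply' _ _ _ hi]
    · refine (Fintype.sum_of_injective e e.injective w _ (fun i hi => ?_) fun j => ?_).symm.trans hw1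
      · simp [Function.extend_apply' _ _ _ hi]
      · simp [e.injective.extend_apply]
    · intro i _
      by_cases hi : ∃ j, e j = i
      · obtain ⟨j, rfl⟩ := hi
        simpa [e.injective.extend_apply] using hz ⟨j, rfl⟩
      · simpa [Function.extend_apply' _ _ _ hi] using hz₀
    · refine (Fintype.sum_of_injective e e.injective _ _ (fun i hi => ?_) fun j => ?_).symm
      · simp [Function.extend_apply' _ _ _ hi]
      · simp [e.injective.extend_apply]
  · rintro _ ⟨⟨w, z⟩, ⟨⟨hw, hw1⟩, hz⟩, rfl⟩
    exact (convex_convexHull ℝ s).sum_mem (fun i _ => hw i) hw1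
      fun i _ => subset_convexHull ℝ s (hz i (Set.mem_univ i))

lemma natEnt_mix {ι : Type*} [Fintype ι] [Fintype α] (w : ι → ℝ) (f : ι → α → ℝ) :
    natEnt (fun a : ι × α => w a.1 * f a.1 a.2) =
      ∑ i, ((∑ a, f i a) * Real.negMulLog (w i) + w i * natEnt (f i)) := by
  simp only [natEnt, Fintype.sum_prod_type, Real.negMulLog_mul, Finset.sum_add_distrib,
    Finset.sum_mul, Finset.mul_sum]

lemma cmi_eq_zero_of_mul_eq [Fintype Ω] [Fintype α] [Fintype β] [Fintype γ]
    [DecidableEq α] [DecidableEq β] [DecidableEq γ] {μ : Ω → ℝ} (hμ : IsPMF μ)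
    (X : Ω → α) (Y : Ω → β) (Z : Ω → γ)
    (h : ∀ x y z, distr μ (fun ω => (X ω, Y ω, Z ω)) (x, y, z) * distr μ Z z =
      distr μ (fun ω => (X ω, Z ω)) (x, z) * distr μ (fun ω => (Y ω, Z ω)) (y, z)) :
    cmi μ X Y Z = 0 := by
  simp only [cmi, H, entFun_eq_natEnt_div, ← sub_div, ← add_div]
  rw [div_eq_zero_iff]
  left
  simp only [natEnt_distr, ← Finset.sum_sub_distrib, ← Finset.sum_add_distrib]
  refine Finset.sum_eq_zero fun ω _ => ?_
  by_cases hω : μ ω = 0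
  · simp [hω]
  · have h0 := (hμ.1 ω).lt_of_ne' hω
    have h1 := h0.trans_le (le_distr_apply hμ.1 (fun ω => (X ω, Y ω, Z ω)) ω)
    have h2 := h0.trans_le (le_distr_apply hμ.1 (fun ω => (X ω, Z ω)) ω)
    have h3 := h0.trans_le (le_distr_apply hμ.1 (fun ω => (Y ω, Z ω)) ω)
    have h4 := h0.trans_le (le_distr_apply hμ.1 Z ω)
    have := congrArg Real.log (h (X ω) (Y ω) (Z ω))
    rw [Real.log_mul h1.ne' h4.ne', Real.log_mul h2.ne' h3.ne'] at this
    linear_combination μ ω * this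

section Local

variable [Fintype 𝒳₁] [Fintype 𝒳₂] [Fintype 𝒴₁] [Fintype 𝒴₂]

/-- The `x²`-marginal. -/
def margTwo (f : 𝒳₁ × 𝒳₂ × 𝒴₁ × 𝒴₂ → ℝ) : 𝒳₂ → ℝ :=
  fun x₂ => ∑ x₁, ∑ y₁, ∑ y₂, f (x₁, x₂, y₁, y₂)

/-- The entropy of `(x¹, y¹, y²)` given `x²`, in nats. -/
def condEntTwo (f : 𝒳₁ × 𝒳₂ × 𝒴₁ × 𝒴₂ → ℝ) : ℝ := natEnt f - natEnt (margTwo f)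

/-- The constraints on the law of `(x¹, x², y¹, y²)` given one value of the auxiliary variable:
`x²` is drawn from `x¹` as in `s`, and `y¹ – x¹ – (x², y²)` and `y² – x² – (x¹, y¹)` are
Markov chains. -/
def IsLocal (s : 𝒳₁ × 𝒳₂ → ℝ) (f : 𝒳₁ × 𝒳₂ × 𝒴₁ × 𝒴₂ → ℝ) : Prop :=
  (∀ x₁ x₂, (∑ y₁, ∑ y₂, f (x₁, x₂, y₁, y₂)) * ∑ x₂', s (x₁, x₂') =
    (∑ x₂', ∑ y₁, ∑ y₂, f (x₁, x₂', y₁, y₂)) * s (x₁, x₂)) ∧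
  (∀ x₁ x₂ y₁ y₂, f (x₁, x₂, y₁, y₂) * ∑ x₂', ∑ y₁', ∑ y₂', f (x₁, x₂', y₁', y₂') =
    (∑ x₂', ∑ y₂', f (x₁, x₂', y₁, y₂')) * ∑ y₁', f (x₁, x₂, y₁', y₂)) ∧
  (∀ x₁ x₂ y₁ y₂, f (x₁, x₂, y₁, y₂) * margTwo f x₂ =
    (∑ x₁', ∑ y₁', f (x₁', x₂, y₁', y₂)) * ∑ y₂', f (x₁, x₂, y₁, y₂'))

/-- Pairs consisting of a local law and its conditional entropy. -/
def localSet (s : 𝒳₁ × 𝒳₂ → ℝ) : Set ((𝒳₁ × 𝒳₂ × 𝒴₁ × 𝒴₂ → ℝ) × ℝ) :=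
  (fun f => (f, condEntTwo f)) '' {f | IsPMF f ∧ IsLocal s f}

lemma continuous_condEntTwo :
    Continuous (condEntTwo : (𝒳₁ × 𝒳₂ × 𝒴₁ × 𝒴₂ → ℝ) → ℝ) := by
  unfold condEntTwo natEnt margTwo
  fun_prop

lemma isCompact_localSet (s : 𝒳₁ × 𝒳₂ → ℝ) :
    IsCompact (localSet s : Set ((𝒳₁ × 𝒳₂ × 𝒴₁ × 𝒴₂ → ℝ) × ℝ)) := by
  refine IsCompact.image ?_ (continuous_id.prodMk continuous_condEntTwo)
  refine (isCompact_stdSimplex ℝ (𝒳₁ × 𝒳₂ × 𝒴₁ × 𝒴₂)).inter_right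
    (t := {f | IsLocal s f}) ?_
  unfold IsLocal margTwo
  simp only [Set.ofPred_and, Set.ofPred_forall]
  refine IsClosed.inter ?_ (IsClosed.inter ?_ ?_)
  · exact isClosed_iInter fun _ => isClosed_iInter fun _ =>
      isClosed_eq (by fun_prop) (by fun_prop)
  · exact isClosed_iInter fun _ => isClosed_iInter fun _ => isClosed_iInter fun _ =>
      isClosed_iInter fun _ => isClosed_eq (by fun_prop) (by fun_prop)
  · exact isClosed_iInter fun _ => isClosed_iInter fun _ => isClosed_iInter fun _ =>
      isClosed_iInter fun _ => isClosed_eq (by fun_prop) (by fun_prop)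

end Local

lemma sum_ite_zero {ι : Type*} [Fintype ι] (P : Prop) (d : ι → Decidable P) (f : ι → ℝ) :
    ∑ i, @ite ℝ P (d i) (f i) 0 = @ite ℝ P (Classical.dec P) (∑ i, f i) 0 := by
  by_cases h : P <;> simp [h]

lemma sum_ite_eq_dec {ι : Type*} [Fintype ι] (a : ι) (d : ∀ i, Decidable (i = a)) (f : ι → ℝ) :
    ∑ i, @ite ℝ (i = a) (d i) (f i) 0 = f a := by
  classical
  rw [Finset.sum_eq_single a] <;> simp +contextual

lemma card_le_of_affineIndependent_localSet [Fintype 𝒳₁] [Fintype 𝒳₂] [Fintype 𝒴₁] [Fintype 𝒴₂]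
    {s : 𝒳₁ × 𝒳₂ → ℝ} {ι : Type*} [Fintype ι]
    {z : ι → (𝒳₁ × 𝒳₂ × 𝒴₁ × 𝒴₂ → ℝ) × ℝ} (hz : Set.range z ⊆ localSet s)
    (hind : AffineIndependent ℝ z) :
    Fintype.card ι ≤ Fintype.card (𝒳₁ × 𝒳₂ × 𝒴₁ × 𝒴₂) + 1 := by
  have hlin : LinearIndependent ℝ z := by
    rw [linearIndependent_iff']
    intro t g hg
    refine affineIndependent_iff.1 hind t g ?_ hg
    have h1 : ∀ i, ∑ a, (z i).1 a = 1 := fun i => by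
      obtain ⟨f, ⟨hf, -⟩, hfz⟩ := hz ⟨i, rfl⟩
      simpa [← hfz] using hf.2
    have h2 : ∑ a, (∑ i ∈ t, g i • z i).1 a = 0 := by simp [hg]
    simp only [Prod.fst_sum, Finset.sum_apply, Prod.smul_fst, Pi.smul_apply, smul_eq_mul] at h2
    rw [Finset.sum_comm] at h2
    simpa [← Finset.mul_sum, h1] using h2
  simpa using hlin.fintype_card_le_finrank

/-- A point of the convex hull of the local set gives an auxiliary variable. -/
lemma exists_auxiliary_of_mem_convexHull
    [Fintype 𝒳₁] [DecidableEq 𝒳₁] [Fintype 𝒳₂] [DecidableEq 𝒳₂]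
    [Fintype 𝒴₁] [DecidableEq 𝒴₁] [Fintype 𝒴₂] [DecidableEq 𝒴₂]
    (q : 𝒳₁ × 𝒳₂ × 𝒴₁ × 𝒴₂ → ℝ) {h : ℝ}
    (hh : (q, h) ∈ convexHull ℝ (localSet (srcMarg q))) :
    ∃ (𝒰 : Type) (_ : Fintype 𝒰) (_ : DecidableEq 𝒰)
      (p : 𝒰 × 𝒳₁ × 𝒳₂ × 𝒴₁ × 𝒴₂ → ℝ),
      IsPMF p ∧
      (∀ x₁ x₂ y₁ y₂, (∑ u, p (u, x₁, x₂, y₁, y₂)) = q (x₁, x₂, y₁, y₂)) ∧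
      cmi p (fun a => a.1) (fun a => a.2.2.1) (fun a => a.2.1) = 0 ∧
      cmi p (fun a => a.2.2.2.1) (fun a => (a.2.2.1, a.2.2.2.2))
        (fun a => (a.1, a.2.1)) = 0 ∧
      cmi p (fun a => a.2.2.2.2) (fun a => (a.2.1, a.2.2.2.1))
        (fun a => (a.1, a.2.2.1)) = 0 ∧
      Fintype.card 𝒰 ≤
        Fintype.card 𝒳₁ * Fintype.card 𝒴₁ * Fintype.card 𝒳₂ * Fintype.card 𝒴₂ + 1 ∧
      cmi p (fun a => a.1) (fun a => (a.2.1, a.2.2.2.1, a.2.2.2.2)) (fun a => a.2.2.1) =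
        (condEntTwo q - h) / Real.log 2 := by
  obtain ⟨ι, hι, z, w, hz, hind, hw, hw1, hsum⟩ := eq_pos_convex_span_of_mem_convexHull hh
  classical
  have hcard := card_le_of_affineIndependent_localSet hz hind
  have hz' : ∀ i, ∃ f, (IsPMF f ∧ IsLocal (srcMarg q) f) ∧ (f, condEntTwo f) = z i :=
    fun i => hz ⟨i, rfl⟩
  choose f hf hfz using hz'
  have hsum1 : ∀ v, ∑ i, w i * f i v = q v := fun v => by
    have := congrFun (congrArg Prod.fst hsum) v
    simpa [← hfz, Prod.fst_sum, Finset.sum_apply] using this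
  have hsum2 : ∑ i, w i * condEntTwo (f i) = h := by
    simpa [← hfz, Prod.snd_sum] using congrArg Prod.snd hsum
  let p : ι × 𝒳₁ × 𝒳₂ × 𝒴₁ × 𝒴₂ → ℝ := fun a => w a.1 * f a.1 a.2
  have hp : IsPMF p := by
    refine ⟨fun a => mul_nonneg (hw _).le ((hf _).1.1 _), ?_⟩
    rw [Fintype.sum_prod_type]
    simp [p, ← Finset.mul_sum, (hf _).1.2, hw1]
  have hsnd : distr p (fun a => a.2) = q := by
    funext v
    rw [← hsum1 v]
    simp only [distr, Fintype.sum_prod_type (α₁ := ι)]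
    simp [p]
  have hmarg : ∀ {δ : Type} [DecidableEq δ] (g : 𝒳₁ × 𝒳₂ × 𝒴₁ × 𝒴₂ → δ),
      distr p (fun a => g a.2) = distr q g := fun g => by
    rw [← hsnd, distr_distr]
  refine ⟨ι, hι, inferInstance, p, hp, fun x₁ x₂ y₁ y₂ => hsum1 _, ?_, ?_, ?_, ?_, ?_⟩
  · refine cmi_eq_zero_of_mul_eq hp _ _ _ fun u x₂ x₁ => ?_
    rw [hmarg fun v => v.1, hmarg fun v => (v.2.1, v.1)]
    have := (hf u).2.1 x₁ x₂
    simp only [srcMarg] at this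
    simp only [distr, Fintype.sum_prod_type, Prod.mk.injEq, ite_and, p, sum_ite_zero,
      sum_ite_eq_dec, ← Finset.mul_sum]
    linear_combination w u * this
  · refine cmi_eq_zero_of_mul_eq hp _ _ _ fun y₁ x₂y₂ ux₁ => ?_
    obtain ⟨x₂, y₂⟩ := x₂y₂
    obtain ⟨u, x₁⟩ := ux₁
    have := (hf u).2.2.1 x₁ x₂ y₁ y₂
    simp only [distr, Fintype.sum_prod_type, Prod.mk.injEq, ite_and, p, sum_ite_zero,
      sum_ite_eq_dec, ← Finset.mul_sum]
    linear_combination w u ^ 2 * this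
  · refine cmi_eq_zero_of_mul_eq hp _ _ _ fun y₂ x₁y₁ ux₂ => ?_
    obtain ⟨x₁, y₁⟩ := x₁y₁
    obtain ⟨u, x₂⟩ := ux₂
    have := (hf u).2.2.2 x₁ x₂ y₁ y₂
    simp only [margTwo] at this
    simp only [distr, Fintype.sum_prod_type, Prod.mk.injEq, ite_and, p, sum_ite_zero,
      sum_ite_eq_dec, ← Finset.mul_sum]
    linear_combination w u ^ 2 * this
  · refine hcard.trans (le_of_eq ?_)
    simp only [Fintype.card_prod]
    ring
  · have e1 : natEnt (distr p fun a => ((a.2.1, a.2.2.2.1, a.2.2.2.2), a.2.2.1)) = natEnt q := by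
      rw [← hsnd]
      exact natEnt_comp_injective p (fun a => a.2)
        (g := fun v : 𝒳₁ × 𝒳₂ × 𝒴₁ × 𝒴₂ => ((v.1, v.2.2.1, v.2.2.2), v.2.1))
        fun v v' hv => by simp only [Prod.ext_iff] at hv ⊢; tauto
    have e2 : natEnt (distr p fun a => (a.1, (a.2.1, a.2.2.2.1, a.2.2.2.2), a.2.2.1)) =
        natEnt p := by
      have hid : distr p (fun a => a) = p := by
        funext a
        simp [distr]
      conv_rhs => rw [← hid]
      exact natEnt_comp_injective p (fun a => a)
        (g := fun a : ι × 𝒳₁ × 𝒳₂ × 𝒴₁ × 𝒴₂ => (a.1, (a.2.1, a.2.2.2.1, a.2.2.2.2), a.2.2.1))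
        fun v v' hv => by simp only [Prod.ext_iff] at hv ⊢; tauto
    have e3 : distr p (fun a => a.2.2.1) = margTwo q := by
      rw [hmarg fun v => v.2.1]
      funext x₂
      simp only [distr, margTwo, Fintype.sum_prod_type, sum_ite_zero,
        Finset.sum_ite_eq', Finset.mem_univ, if_true]
    have e4 : distr p (fun a => (a.1, a.2.2.1)) = fun a => w a.1 * margTwo (f a.1) a.2 := by
      funext a
      obtain ⟨u, x₂⟩ := a
      simp only [distr, margTwo, Fintype.sum_prod_type, Prod.mk.injEq, ite_and, p,
        sum_ite_zero, sum_ite_eq_dec,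
        ← Finset.mul_sum]
    have hm1 : ∀ i, ∑ x₂, margTwo (f i) x₂ = 1 := fun i => by
      rw [← (hf i).1.2]
      simp only [margTwo, Fintype.sum_prod_type]
      rw [Finset.sum_comm]
    simp only [cmi, H, entFun_eq_natEnt_div, ← sub_div, ← add_div]
    congr 1
    rw [e1, e2, e3, e4, natEnt_mix w f, natEnt_mix w fun i => margTwo (f i), ← hsum2]
    simp only [hm1, (hf _).1.2, condEntTwo, mul_sub, Finset.sum_add_distrib,
      Finset.sum_sub_distrib, one_mul]
    ring

lemma isLocal_of_factor [Fintype 𝒳₁] [Fintype 𝒳₂] [Fintype 𝒴₁] [Fintype 𝒴₂]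
    {s : 𝒳₁ × 𝒳₂ → ℝ} {f : 𝒳₁ × 𝒳₂ × 𝒴₁ × 𝒴₂ → ℝ} (a : 𝒳₁ → 𝒴₁ → ℝ) (b : 𝒳₂ → 𝒴₂ → ℝ)
    (hb : ∀ x₂, ∑ y₂, b x₂ y₂ = 1)
    (hf : ∀ x₁ x₂ y₁ y₂, f (x₁, x₂, y₁, y₂) = s (x₁, x₂) * a x₁ y₁ * b x₂ y₂) :
    IsLocal s f := by
  refine ⟨fun x₁ x₂ => ?_, fun x₁ x₂ y₁ y₂ => ?_, fun x₁ x₂ y₁ y₂ => ?_⟩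
  · simp only [hf, ← Finset.mul_sum, hb, mul_one, ← Finset.sum_mul]
    ring
  · simp only [hf, ← Finset.mul_sum, hb, mul_one, ← Finset.sum_mul]
    ring
  · simp only [margTwo, hf, ← Finset.mul_sum, hb, mul_one, ← Finset.sum_mul]
    ring

/-- The joint law of sources, message and outputs of a one-message code. -/
lemma distr_code_apply {𝒜 ℬ 𝒞 𝒟 ℰ 𝓜₁ 𝓜₂ : Type*} [Fintype Ω] [Fintype 𝒜] [Fintype ℬ]
    [Fintype 𝓜₁] [Fintype 𝓜₂] [DecidableEq 𝒜] [DecidableEq ℬ] [DecidableEq 𝒞] [DecidableEq 𝒟]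
    [DecidableEq ℰ] [DecidableEq 𝓜₁] [DecidableEq 𝓜₂]
    (μ : Ω → ℝ) (X₁ : Ω → 𝒜) (X₂ : Ω → ℬ) (M₁ : Ω → 𝓜₁) (M₂ : Ω → 𝓜₂) (s : 𝒜 × ℬ → ℝ)
    (hind : distr μ (fun ω => (M₁ ω, M₂ ω, X₁ ω, X₂ ω)) =
      fun m => distr μ M₁ m.1 * distr μ M₂ m.2.1 * s m.2.2)
    (fc : 𝒜 → 𝓜₁ → 𝒞) (f₁ : 𝒜 → 𝓜₁ → 𝒟) (f₂ : ℬ → 𝓜₂ → 𝒞 → ℰ)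
    (x₁ : 𝒜) (x₂ : ℬ) (c : 𝒞) (y₁ : 𝒟) (y₂ : ℰ) :
    distr μ (fun ω => (X₁ ω, X₂ ω, fc (X₁ ω) (M₁ ω), f₁ (X₁ ω) (M₁ ω),
        f₂ (X₂ ω) (M₂ ω) (fc (X₁ ω) (M₁ ω)))) (x₁, x₂, c, y₁, y₂) =
      s (x₁, x₂) * distr (distr μ M₁) (fun m => (fc x₁ m, f₁ x₁ m)) (c, y₁) *
        distr (distr μ M₂) (fun m => f₂ x₂ m c) y₂ := by
  rw [← distr_distr μ (fun ω => (M₁ ω, M₂ ω, X₁ ω, X₂ ω)) fun z =>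
    (z.2.2.1, z.2.2.2, fc z.2.2.1 z.1, f₁ z.2.2.1 z.1, f₂ z.2.2.2 z.2.1 (fc z.2.2.1 z.1)), hind]
  generalize distr μ M₁ = P₁
  generalize distr μ M₂ = P₂
  rw [distr, distr, distr, Fintype.sum_prod_type, mul_assoc, Finset.sum_mul_sum, Finset.mul_sum]
  refine Finset.sum_congr rfl fun m₁ _ => ?_
  rw [Fintype.sum_prod_type, Finset.mul_sum]
  refine Finset.sum_congr rfl fun m₂ _ => ?_
  rw [Fintype.sum_eq_single (x₁, x₂)]
  · by_cases h1 : fc x₁ m₁ = c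
    · subst h1
      by_cases h2 : f₁ x₁ m₁ = y₁ <;> by_cases h3 : f₂ x₂ m₂ (fc x₁ m₁) = y₂ <;> simp [h2, h3]
      ring
    · simp [h1]
  · rintro ⟨x, x'⟩ hx
    refine if_neg fun h => hx ?_
    simp only [Prod.ext_iff] at h ⊢
    tauto

/-- The law of a single letter and of the message together with the remaining side information
factorizes when the block law does. -/
lemma distr_letter_eq [Fintype 𝒳₁] [DecidableEq 𝒳₁] [Fintype 𝒳₂] [DecidableEq 𝒳₂]
    [Fintype 𝒴₁] [DecidableEq 𝒴₁] [Fintype 𝒴₂] [DecidableEq 𝒴₂]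
    {𝒞 : Type*} [Fintype 𝒞] [DecidableEq 𝒞] {n : ℕ} (s : 𝒳₁ × 𝒳₂ → ℝ)
    (A : (Fin n → 𝒳₁) → 𝒞 → (Fin n → 𝒴₁) → ℝ) (B : (Fin n → 𝒳₂) → 𝒞 → (Fin n → 𝒴₂) → ℝ)
    (hB : ∀ x₂ c, ∑ y₂, B x₂ c y₂ = 1)
    (G : (Fin n → 𝒳₁) × (Fin n → 𝒳₂) × 𝒞 × (Fin n → 𝒴₁) × (Fin n → 𝒴₂) → ℝ)
    (hG : ∀ x₁ x₂ c y₁ y₂,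
      G (x₁, x₂, c, y₁, y₂) = (∏ k, s (x₁ k, x₂ k)) * A x₁ c y₁ * B x₂ c y₂)
    (k : Fin n) (u : 𝒞 × ({j // j ≠ k} → 𝒳₂)) :
    ∃ (a : 𝒳₁ → 𝒴₁ → ℝ) (b : 𝒳₂ → 𝒴₂ → ℝ), (∀ x₂, ∑ y₂, b x₂ y₂ = 1) ∧
      ∀ x₁ x₂ y₁ y₂, distr G (fun z => ((z.2.2.1, fun j : {j // j ≠ k} => z.2.1 j),
        (z.1 k, z.2.1 k, z.2.2.2.1 k, z.2.2.2.2 k))) (u, (x₁, x₂, y₁, y₂)) =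
          s (x₁, x₂) * a x₁ y₁ * b x₂ y₂ := by
  obtain ⟨c, t⟩ := u
  let e : 𝒳₂ → Fin n → 𝒳₂ := fun x₂ => (Equiv.funSplitAt k 𝒳₂).symm (x₂, t)
  have hek : ∀ x₂, e x₂ k = x₂ := fun x₂ => by simp [e]
  have hej : ∀ x₂ (j : {j // j ≠ k}), e x₂ j = t j := fun x₂ j => by simp [e, j.2]
  refine ⟨fun x₁ y₁ => ∑ v : Fin n → 𝒳₁, ∑ w : Fin n → 𝒴₁, if v k = x₁ ∧ w k = y₁ then
      (∏ j : {j // j ≠ k}, s (v j, t j)) * A v c w else 0,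
    fun x₂ y₂ => distr (B (e x₂) c) (fun w => w k) y₂, fun x₂ => ?_, fun x₁ x₂ y₁ y₂ => ?_⟩
  · rw [sum_distr, hB]
  · simp only [distr, Fintype.sum_prod_type]
    rw [mul_assoc, Finset.sum_mul, Finset.mul_sum]
    refine Finset.sum_congr rfl fun v _ => ?_
    rw [Finset.sum_mul_sum]
    simp only [Finset.mul_sum]
    refine (Fintype.sum_eq_single (e x₂) fun x hx => ?_).trans
      ((Fintype.sum_eq_single c fun c' hc' => ?_).trans ?_)
    · have : ¬ ((fun j : {j // j ≠ k} => x j) = t ∧ x k = x₂) := by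
        rintro ⟨h1, h2⟩
        refine hx (funext fun j => ?_)
        by_cases hj : j = k
        · rw [hj, h2, hek]
        · rw [hej x₂ ⟨j, hj⟩, ← h1]
      refine Finset.sum_eq_zero fun _ _ => Finset.sum_eq_zero fun _ _ =>
        Finset.sum_eq_zero fun _ _ => if_neg fun h => this ?_
      simp only [Prod.mk.injEq] at h
      tauto
    · simp [hc']
    · refine Finset.sum_congr rfl fun w _ => Finset.sum_congr rfl fun w' _ => ?_
      have he : (fun j : {j // j ≠ k} => e x₂ j) = t := funext (hej x₂)
      rw [hG, Fintype.prod_eq_mul_prod_subtype_ne _ k]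
      simp only [hek, hej, Prod.mk.injEq, true_and]
      by_cases h1 : v k = x₁
      · by_cases h2 : w k = y₁ <;> by_cases h3 : w' k = y₂ <;> simp [h1, h2, h3]
        ring
      · simp [h1]

/-- A law that is local given each value of `U` lies, together with its conditional entropy, in the
convex hull of the local set. -/
lemma distr_mem_convexHull_localSet [Fintype Ω] [Fintype β] [DecidableEq β]
    [Fintype 𝒳₁] [DecidableEq 𝒳₁] [Fintype 𝒳₂] [DecidableEq 𝒳₂]
    [Fintype 𝒴₁] [DecidableEq 𝒴₁] [Fintype 𝒴₂] [DecidableEq 𝒴₂]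
    {μ : Ω → ℝ} (hμ : IsPMF μ) (s : 𝒳₁ × 𝒳₂ → ℝ) (U : Ω → β) (V : Ω → 𝒳₁ × 𝒳₂ × 𝒴₁ × 𝒴₂)
    (hUV : ∀ u, ∃ (a : 𝒳₁ → 𝒴₁ → ℝ) (b : 𝒳₂ → 𝒴₂ → ℝ), (∀ x₂, ∑ y₂, b x₂ y₂ = 1) ∧
      ∀ x₁ x₂ y₁ y₂, distr μ (fun ω => (U ω, V ω)) (u, (x₁, x₂, y₁, y₂)) =
        s (x₁, x₂) * a x₁ y₁ * b x₂ y₂) :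
    (distr μ V, natEnt (distr μ fun ω => (U ω, V ω)) -
      natEnt (distr μ fun ω => (U ω, (V ω).2.1))) ∈ convexHull ℝ (localSet s) := by
  set D := distr μ fun ω => (U ω, V ω) with hD
  have hDpmf : IsPMF D := hμ.distr _
  have hP : ∀ u, ∑ v, D (u, v) = distr μ U u := fun u => by
    rw [← sum_distr_pair μ V U u]
    simp [hD, distr, and_comm]
  have hV : ∀ v, ∑ u, D (u, v) = distr μ V v := sum_distr_pair μ U V
  set P := distr μ U with hPdef
  have hP0 : ∀ u, 0 ≤ P u := distr_nonneg hμ.1 U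
  let f : β → 𝒳₁ × 𝒳₂ × 𝒴₁ × 𝒴₂ → ℝ := fun u v => (P u)⁻¹ * D (u, v)
  have hf : ∀ u v, P u * f u v = D (u, v) := fun u v => by
    by_cases hu : P u = 0
    · have : D (u, v) = 0 := le_antisymm
        (hu ▸ hP u ▸ Finset.single_le_sum (fun v _ => hDpmf.1 (u, v)) (Finset.mem_univ v))
        (hDpmf.1 _)
      simp [hu, this]
    · simp [f, hu]
  have hmem : ∀ u, P u ≠ 0 → (f u, condEntTwo (f u)) ∈ localSet s := fun u hu => by
    refine ⟨f u, ⟨⟨fun v => mul_nonneg (inv_nonneg.2 (hP0 u)) (hDpmf.1 _), ?_⟩, ?_⟩, rfl⟩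
    · simp only [f, ← Finset.mul_sum, hP, inv_mul_cancel₀ hu]
    · obtain ⟨a, b, hb, hab⟩ := hUV u
      refine isLocal_of_factor (fun x₁ y₁ => (P u)⁻¹ * a x₁ y₁) b hb fun x₁ x₂ y₁ y₂ => ?_
      simp only [f, hab]
      ring
  have hcomb := (convex_convexHull ℝ (localSet s)).sum_mem
    (t := Finset.univ.filter fun u => P u ≠ 0) (w := P) (z := fun u => (f u, condEntTwo (f u)))
    (fun u _ => hP0 u)
    (by rw [Finset.sum_filter_ne_zero]; exact (hμ.distr U).2)
    fun u hu => subset_convexHull ℝ _ (hmem u (Finset.mem_filter.1 hu).2)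
  rw [Finset.sum_filter_of_ne (p := fun u => P u ≠ 0) fun u _ hu hPu => hu (by rw [hPu, zero_smul])] at hcomb
  convert hcomb using 1
  ext v
  · simp [Prod.fst_sum, Finset.sum_apply, hf, hV]
  · have e1 : D = fun z => P z.1 * f z.1 z.2 := funext fun z => (hf z.1 z.2).symm
    have e2 : (distr μ fun ω => (U ω, (V ω).2.1)) = fun z => P z.1 * margTwo (f z.1) z.2 := by
      rw [← distr_distr μ (fun ω => (U ω, V ω)) fun z => (z.1, z.2.2.1)]
      funext z
      obtain ⟨u, x₂⟩ := z
      rw [← hD, e1]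
      simp only [distr, margTwo, Fintype.sum_prod_type, Prod.mk.injEq, ite_and, sum_ite_zero,
        sum_ite_eq_dec, Finset.mul_sum]
    have e3 : ∀ u, ∑ x₂, margTwo (f u) x₂ = ∑ v, f u v := fun u => by
      simp only [margTwo, Fintype.sum_prod_type]
      rw [Finset.sum_comm]
    rw [e2]
    conv_lhs => rw [e1]
    rw [natEnt_mix P f, natEnt_mix P fun u => margTwo (f u)]
    simp only [e3, Prod.snd_sum, Prod.smul_snd, smul_eq_mul, condEntTwo, mul_sub,
      Finset.sum_add_distrib, Finset.sum_sub_distrib]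
    ring

lemma natEnt_pi_le [Fintype Ω] [Fintype α] [DecidableEq α] {μ : Ω → ℝ} (hμ : IsPMF μ) {n : ℕ}
    (A : Fin n → Ω → α) :
    natEnt (distr μ fun ω k => A k ω) ≤ ∑ k, natEnt (distr μ (A k)) := by
  have h := natEnt_pi_pair_le hμ A fun _ => ()
  have h0 : natEnt (distr μ fun _ => ()) = 0 := by
    simp [natEnt, distr, hμ.2]
  have e := fun k => natEnt_comp_injective μ (A k) (Prod.mk_left_injective ())
  rw [natEnt_comp_injective μ (fun ω k => A k ω) (Prod.mk_left_injective ())] at h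
  simpa only [h0, e, zero_add, sub_zero] using h

lemma natEnt_block_le {𝒞 𝒮 : Type*} [Fintype Ω] [Fintype α] [DecidableEq α] [Fintype 𝒞]
    [DecidableEq 𝒞] [Fintype 𝒮] [DecidableEq 𝒮] {μ : Ω → ℝ} (hμ : IsPMF μ) {n : ℕ}
    (C : Ω → 𝒞) (V : Fin n → Ω → α) (g : α → 𝒮) :
    natEnt (distr μ fun ω k => V k ω) ≤ natEnt (distr μ C) +
      ∑ k, natEnt (distr μ fun ω => g (V k ω)) +
      ∑ k, (natEnt (distr μ fun ω =>
          ((C ω, fun j : {j // j ≠ k} => g (V j ω)), V k ω)) -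
        natEnt (distr μ fun ω => ((C ω, fun j : {j // j ≠ k} => g (V j ω)), g (V k ω)))) := by
  have h1 := natEnt_comp_le hμ.1 (fun ω => ((fun k => V k ω), (C ω, fun k => g (V k ω)))) Prod.fst
  have h2 := natEnt_pi_pair_le hμ V fun ω => (C ω, fun k => g (V k ω))
  have h3 := natEnt_pair_le hμ C fun ω k => g (V k ω)
  have h4 := natEnt_pi_le hμ fun k ω => g (V k ω)
  have h5 : ∀ k, natEnt (distr μ fun ω => (V k ω, (C ω, fun k => g (V k ω)))) ≤
      natEnt (distr μ fun ω => ((C ω, fun j : {j // j ≠ k} => g (V j ω)), V k ω)) := fun k => by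
    convert natEnt_comp_le hμ.1
      (fun ω => ((C ω, fun j : {j // j ≠ k} => g (V j ω)), V k ω))
      (fun z => (z.2, (z.1.1, (Equiv.funSplitAt k 𝒮).symm (g z.2, z.1.2)))) using 5 with ω
    exact Prod.ext rfl ((Equiv.funSplitAt k 𝒮).symm_apply_apply fun j => g (V j ω)).symm
  have h6 : ∀ k, natEnt (distr μ fun ω =>
      ((C ω, fun j : {j // j ≠ k} => g (V j ω)), g (V k ω))) ≤
      natEnt (distr μ fun ω => (C ω, fun k => g (V k ω))) := fun k =>
    natEnt_comp_le hμ.1 (fun ω => (C ω, fun k => g (V k ω)))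
      fun z => ((z.1, fun j : {j // j ≠ k} => z.2 j), z.2 k)
  have h7 := Finset.sum_le_sum fun k (_ : k ∈ Finset.univ) => sub_le_sub (h5 k) (h6 k)
  linarith

lemma distr_equiv [Fintype α] [DecidableEq β] (p : α → ℝ) (e : α ≃ β) :
    distr p e = fun b => p (e.symm b) := by
  funext b
  rw [distr, Fintype.sum_eq_single (e.symm b) fun a ha => if_neg fun h => ha ?_]
  · simp
  · rw [← h, e.symm_apply_apply]

/-- A vector of quadruples, seen as a quadruple of vectors. -/
def zipFour (n : ℕ) (𝒜 ℬ 𝒞 𝒟 : Type*) :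
    (Fin n → 𝒜) × (Fin n → ℬ) × (Fin n → 𝒞) × (Fin n → 𝒟) ≃ (Fin n → 𝒜 × ℬ × 𝒞 × 𝒟) where
  toFun a k := (a.1 k, a.2.1 k, a.2.2.1 k, a.2.2.2 k)
  invFun v := (fun k => (v k).1, fun k => (v k).2.1, fun k => (v k).2.2.1, fun k => (v k).2.2.2)
  left_inv _ := rfl
  right_inv _ := rfl

section Marginals

variable [Fintype 𝒳₁] [DecidableEq 𝒳₁] [Fintype 𝒳₂] [DecidableEq 𝒳₂] [Fintype 𝒴₁] [Fintype 𝒴₂]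

lemma distr_eq_srcMarg (q : 𝒳₁ × 𝒳₂ × 𝒴₁ × 𝒴₂ → ℝ) :
    distr q (fun v => (v.1, v.2.1)) = srcMarg q := by
  funext x
  simp only [distr, srcMarg, Fintype.sum_prod_type, Prod.ext_iff, ite_and, sum_ite_zero,
    sum_ite_eq_dec]

lemma distr_eq_margTwo (q : 𝒳₁ × 𝒳₂ × 𝒴₁ × 𝒴₂ → ℝ) :
    distr q (fun v => v.2.1) = margTwo q := by
  funext x₂
  simp only [distr, margTwo, Fintype.sum_prod_type, sum_ite_zero, sum_ite_eq_dec]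

lemma distr_letter_eq_margTwo [Fintype Ω] {q : 𝒳₁ × 𝒳₂ × 𝒴₁ × 𝒴₂ → ℝ} (hq : IsPMF q) {n : ℕ}
    (μ : Ω → ℝ) (X₁ : Ω → Fin n → 𝒳₁) (X₂ : Ω → Fin n → 𝒳₂)
    (hsrc : distr μ (fun ω => (X₁ ω, X₂ ω)) = fun x => ∏ k, srcMarg q (x.1 k, x.2 k))
    (k : Fin n) : distr μ (fun ω => X₂ ω k) = margTwo q := by
  have hs : IsPMF (srcMarg q) := distr_eq_srcMarg q ▸ hq.distr _
  let e : (Fin n → 𝒳₁) × (Fin n → 𝒳₂) ≃ (Fin n → 𝒳₁ × 𝒳₂) :=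
    (Equiv.arrowProdEquivProdArrow (Fin n) (fun _ => 𝒳₁) fun _ => 𝒳₂).symm
  have h1 : distr μ (fun ω => e (X₁ ω, X₂ ω)) = fun v => ∏ j, srcMarg q (v j) := by
    rw [← distr_distr μ (fun ω => (X₁ ω, X₂ ω)) e, hsrc, distr_equiv]
    rfl
  have h2 := distr_distr μ (fun ω => e (X₁ ω, X₂ ω)) fun v => v k
  rw [h1, distr_pi_prod_apply hs k] at h2
  have h3 := distr_distr μ (fun ω => e (X₁ ω, X₂ ω) k) Prod.snd
  rw [← h2, ← distr_eq_srcMarg, distr_distr, distr_eq_margTwo] at h3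
  exact h3.symm

end Marginals

set_option synthInstance.maxSize 1000 in
lemma exists_mem_convexHull_of_code {𝒞 𝓜₁ 𝓜₂ : Type} [Fintype Ω] [Fintype 𝒞] [DecidableEq 𝒞]
    [Fintype 𝓜₁] [DecidableEq 𝓜₁] [Fintype 𝓜₂] [DecidableEq 𝓜₂]
    [Fintype 𝒳₁] [DecidableEq 𝒳₁] [Fintype 𝒳₂] [DecidableEq 𝒳₂]
    [Fintype 𝒴₁] [DecidableEq 𝒴₁] [Fintype 𝒴₂] [DecidableEq 𝒴₂]
    {q : 𝒳₁ × 𝒳₂ × 𝒴₁ × 𝒴₂ → ℝ} (hq : IsPMF q) {n : ℕ} (hn : 0 < n) {ε : ℝ}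
    {μ : Ω → ℝ} (hμ : IsPMF μ) (X₁ : Ω → Fin n → 𝒳₁) (X₂ : Ω → Fin n → 𝒳₂)
    (M₁ : Ω → 𝓜₁) (M₂ : Ω → 𝓜₂) (C : Ω → 𝒞) (Y₁ : Ω → Fin n → 𝒴₁) (Y₂ : Ω → Fin n → 𝒴₂)
    (hsrc : distr μ (fun ω => (X₁ ω, X₂ ω)) = fun x => ∏ k, srcMarg q (x.1 k, x.2 k))
    (hind : distr μ (fun ω => (M₁ ω, M₂ ω, X₁ ω, X₂ ω)) =
      fun m => distr μ M₁ m.1 * distr μ M₂ m.2.1 * distr μ (fun ω => (X₁ ω, X₂ ω)) m.2.2)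
    (fc : (Fin n → 𝒳₁) → 𝓜₁ → 𝒞) (f₁ : (Fin n → 𝒳₁) → 𝓜₁ → Fin n → 𝒴₁)
    (f₂ : (Fin n → 𝒳₂) → 𝓜₂ → 𝒞 → Fin n → 𝒴₂)
    (hC : ∀ ω, μ ω ≠ 0 → C ω = fc (X₁ ω) (M₁ ω))
    (hY₁ : ∀ ω, μ ω ≠ 0 → Y₁ ω = f₁ (X₁ ω) (M₁ ω))
    (hY₂ : ∀ ω, μ ω ≠ 0 → Y₂ ω = f₂ (X₂ ω) (M₂ ω) (C ω))
    (hε : l1dist (distr μ (fun ω => (X₁ ω, X₂ ω, Y₁ ω, Y₂ ω)))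
      (fun a => ∏ k, q (a.1 k, a.2.1 k, a.2.2.1 k, a.2.2.2 k)) ≤ ε) :
    ∃ z ∈ convexHull ℝ (localSet (srcMarg q)), (∀ v, |z.1 v - q v| ≤ ε) ∧
      n * (condEntTwo q - z.2 - ε * Real.log (Fintype.card (𝒳₁ × 𝒳₂ × 𝒴₁ × 𝒴₂))) - 1 ≤
        natEnt (distr μ C) := by
  have hn0 : (n : ℝ) ≠ 0 := by positivity
  let V : Fin n → Ω → 𝒳₁ × 𝒳₂ × 𝒴₁ × 𝒴₂ := fun k ω => (X₁ ω k, X₂ ω k, Y₁ ω k, Y₂ ω k)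
  let U : ∀ k : Fin n, Ω → 𝒞 × ({j // j ≠ k} → 𝒳₂) := fun k ω => (C ω, fun j => X₂ ω j)
  have hfactor : ∀ x₁ x₂ c y₁ y₂, distr μ (fun ω => (X₁ ω, X₂ ω, C ω, Y₁ ω, Y₂ ω))
      (x₁, x₂, c, y₁, y₂) = (∏ k, srcMarg q (x₁ k, x₂ k)) *
        distr (distr μ M₁) (fun m => (fc x₁ m, f₁ x₁ m)) (c, y₁) *
        distr (distr μ M₂) (fun m => f₂ x₂ m c) y₂ := fun x₁ x₂ c y₁ y₂ => by
    rw [← distr_code_apply μ X₁ X₂ M₁ M₂ (fun x => ∏ k, srcMarg q (x.1 k, x.2 k))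
      (by rw [hind, hsrc]) fc f₁ f₂]
    exact congrFun (distr_congr fun ω hω => by rw [hY₂ ω hω, hY₁ ω hω, hC ω hω]) _
  have hmem : ∀ k, (distr μ (V k), natEnt (distr μ fun ω => (U k ω, V k ω)) -
      natEnt (distr μ fun ω => (U k ω, (V k ω).2.1))) ∈ convexHull ℝ (localSet (srcMarg q)) :=
    fun k => distr_mem_convexHull_localSet hμ _ (U k) (V k) fun u => by
      obtain ⟨a, b, hb, hab⟩ := distr_letter_eq (srcMarg q)
        (fun x₁ c y₁ => distr (distr μ M₁) (fun m => (fc x₁ m, f₁ x₁ m)) (c, y₁))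
        (fun x₂ c y₂ => distr (distr μ M₂) (fun m => f₂ x₂ m c) y₂)
        (fun x₂ c => by rw [sum_distr, (hμ.distr M₂).2]) _ hfactor k u
      refine ⟨a, b, hb, fun x₁ x₂ y₁ y₂ => ?_⟩
      rw [← hab, distr_distr]
  have hl1 : l1dist (distr μ fun ω k => V k ω) (fun v => ∏ k, q (v k)) ≤ ε := by
    refine le_trans ?_ hε
    have := l1dist_distr_le (distr μ fun ω => (X₁ ω, X₂ ω, Y₁ ω, Y₂ ω))
      (fun a => ∏ k, q (a.1 k, a.2.1 k, a.2.2.1 k, a.2.2.2 k)) (zipFour n 𝒳₁ 𝒳₂ 𝒴₁ 𝒴₂)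
    rw [distr_distr, distr_equiv] at this
    exact this
  have hletter : ∀ k v, |distr μ (V k) v - q v| ≤ ε := fun k v => by
    have := l1dist_distr_le (distr μ fun ω k => V k ω) (fun v => ∏ k, q (v k)) fun v => v k
    rw [distr_distr, distr_pi_prod_apply hq k] at this
    exact (Finset.single_le_sum (f := fun v => |distr μ (V k) v - q v|)
      (fun _ _ => abs_nonneg _) (Finset.mem_univ v)).trans (this.trans hl1)
  refine ⟨∑ k, (n : ℝ)⁻¹ • (distr μ (V k), natEnt (distr μ fun ω => (U k ω, V k ω)) -
      natEnt (distr μ fun ω => (U k ω, (V k ω).2.1))),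
    (convex_convexHull ℝ _).sum_mem (fun _ _ => by positivity) (by simp [hn0])
      fun k _ => hmem k, fun v => ?_, ?_⟩
  · have h1 : (∑ k, (n : ℝ)⁻¹ • (distr μ (V k), natEnt (distr μ fun ω => (U k ω, V k ω)) -
        natEnt (distr μ fun ω => (U k ω, (V k ω).2.1)))).1 v - q v =
        ∑ k, (n : ℝ)⁻¹ * (distr μ (V k) v - q v) := by
      simp [Prod.fst_sum, Finset.sum_apply, mul_sub, hn0]
    rw [h1]
    refine (Finset.abs_sum_le_sum_abs _ _).trans
      ((Finset.sum_le_sum (g := fun _ => (n : ℝ)⁻¹ * ε) fun k _ => ?_).trans_eq (by simp [hn0]))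
    rw [abs_mul, abs_of_nonneg (by positivity)]
    exact mul_le_mul_of_nonneg_left (hletter k v) (by positivity)
  · have hent := natEnt_le_add_l1dist (hμ.distr fun ω k => V k ω) (IsPMF.pi_prod hq n)
    rw [natEnt_pi_prod hq n, Fintype.card_fun, Fintype.card_fin, Nat.cast_pow, Real.log_pow]
      at hent
    have hX₂ : ∀ k, (distr μ fun ω => (V k ω).2.1) = margTwo q :=
      distr_letter_eq_margTwo hq μ X₁ X₂ hsrc
    have hblock : natEnt (distr μ fun ω k => V k ω) ≤
        natEnt (distr μ C) + n * natEnt (margTwo q) +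
          ∑ k, (natEnt (distr μ fun ω => (U k ω, V k ω)) -
            natEnt (distr μ fun ω => (U k ω, (V k ω).2.1))) := by
      have := natEnt_block_le hμ C V fun v => v.2.1
      simp only [hX₂, Finset.sum_const, Finset.card_univ, Fintype.card_fin, nsmul_eq_mul] at this
      exact this
    have hlog : 0 ≤ n * Real.log (Fintype.card (𝒳₁ × 𝒳₂ × 𝒴₁ × 𝒴₂)) :=
      mul_nonneg n.cast_nonneg (Real.log_natCast_nonneg _)
    have := mul_le_mul_of_nonneg_right hl1 hlog
    simp only [Prod.snd_sum, Prod.smul_snd, smul_eq_mul, ← Finset.mul_sum, condEntTwo]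
    rw [mul_sub, mul_sub, mul_inv_cancel_left₀ hn0]
    linarith

lemma exists_mem_convexHull_of_admissible
    [Fintype 𝒳₁] [DecidableEq 𝒳₁] [Fintype 𝒳₂] [DecidableEq 𝒳₂]
    [Fintype 𝒴₁] [DecidableEq 𝒴₁] [Fintype 𝒴₂] [DecidableEq 𝒴₂]
    {q : 𝒳₁ × 𝒳₂ × 𝒴₁ × 𝒴₂ → ℝ} (hq : IsPMF q) {R12 R21 : ℝ} (hadm : Admissible q 1 R12 R21)
    {ε : ℝ} (hε : 0 < ε) :
    ∃ z ∈ convexHull ℝ (localSet (srcMarg q)), (∀ v, |z.1 v - q v| ≤ ε) ∧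
      condEntTwo q - z.2 - ε * (Real.log (Fintype.card (𝒳₁ × 𝒳₂ × 𝒴₁ × 𝒴₂)) + 1) ≤
        R12 * Real.log 2 := by
  obtain ⟨n₀, hn₀⟩ := hadm ε hε
  obtain ⟨m, hm⟩ := exists_nat_gt (1 / ε)
  have hm0 : 0 < m := by exact_mod_cast (one_div_pos.2 hε).trans hm
  obtain ⟨Ω, 𝓜₁, 𝓜₂, 𝓒, _, _, _, _, _, _, _, _, μ, X₁, X₂, M₁, M₂, C, Y₁, Y₂, hμ, hsrc, hind,
    hodd, -, hR, -, hY₁, hY₂, hl1⟩ := hn₀ (max n₀ m) (le_max_left _ _)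
  have hn : m ≤ max n₀ m := le_max_right _ _
  generalize max n₀ m = n at *
  obtain ⟨fc, hfc⟩ := exists_eq_comp_of_condEnt_eq_zero hμ _ _ (hodd 0 rfl)
  obtain ⟨f₁, hf₁⟩ := exists_eq_comp_of_condEnt_eq_zero hμ _ _ hY₁
  obtain ⟨f₂, hf₂⟩ := exists_eq_comp_of_condEnt_eq_zero hμ _ _ hY₂
  have hC : ∀ ω, (fun i => C i ω) = (uniqueElim (C 0 ω) : ∀ i, 𝓒 i) := fun ω =>
    funext fun i => by
      obtain rfl : i = default := Subsingleton.elim _ _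
      exact (uniqueElim_default _).symm
  have hC0 : ∀ ω, μ ω ≠ 0 → C 0 ω = fc (fun j => j.elim0, X₁ ω, M₁ ω) := fun ω hω => by
    rw [hfc ω hω]
    exact congrArg (fun t => fc (t, X₁ ω, M₁ ω)) (funext fun j => j.elim0)
  obtain ⟨z, hz, hzq, hzR⟩ := exists_mem_convexHull_of_code hq (hm0.trans_le hn) hμ X₁ X₂ M₁ M₂
    (C 0) Y₁ Y₂ hsrc hind (fun x m => fc (fun j => j.elim0, x, m))
    (fun x m => f₁ (x, m, uniqueElim (fc (fun j => j.elim0, x, m))))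
    (fun x m c => f₂ (x, m, uniqueElim c)) hC0
    (fun ω hω => by rw [hf₁ ω hω, hC, hC0 ω hω]) (fun ω hω => by rw [hf₂ ω hω, hC]) hl1
  refine ⟨z, hz, hzq, ?_⟩
  have hlog : 0 < Real.log 2 := Real.log_pos one_lt_two
  have hR' : natEnt (distr μ (C 0)) ≤ n * (R12 * Real.log 2) := by
    have : H μ (C 0) ≤ n * R12 := by simpa [Finset.sum_filter] using hR
    rw [H, entFun_eq_natEnt_div, div_le_iff₀ hlog] at this
    linarith
  have hnR : (m : ℝ) ≤ n := by exact_mod_cast hn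
  have hn0 : (0 : ℝ) < n := by exact_mod_cast hm0.trans_le hn
  have h1 : 1 ≤ n * ε := by
    rw [div_lt_iff₀ hε] at hm
    exact hm.le.trans (mul_le_mul_of_nonneg_right hnR hε.le)
  refine le_of_mul_le_mul_left ?_ hn0
  linarith

/-- The rate is at least the conditional-entropy gap at some point of the convex hull above `q`. -/
lemma exists_mem_convexHull_le_rate
    [Fintype 𝒳₁] [DecidableEq 𝒳₁] [Fintype 𝒳₂] [DecidableEq 𝒳₂]
    [Fintype 𝒴₁] [DecidableEq 𝒴₁] [Fintype 𝒴₂] [DecidableEq 𝒴₂]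
    {q : 𝒳₁ × 𝒳₂ × 𝒴₁ × 𝒴₂ → ℝ} (hq : IsPMF q) {R12 R21 : ℝ} (hadm : Admissible q 1 R12 R21) :
    ∃ h, (q, h) ∈ convexHull ℝ (localSet (srcMarg q)) ∧
      condEntTwo q - h ≤ R12 * Real.log 2 := by
  choose z hz hzq hzR using fun k : ℕ =>
    exists_mem_convexHull_of_admissible hq hadm (Nat.one_div_pos_of_nat (α := ℝ) (n := k))
  obtain ⟨⟨q', h⟩, hmem, φ, hφ, hlim⟩ :=
    (isCompact_convexHull (isCompact_localSet (srcMarg q))).tendsto_subseq hz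
  have hε : Filter.Tendsto (fun k => 1 / ((φ k : ℝ) + 1)) Filter.atTop (nhds 0) :=
    tendsto_one_div_add_atTop_nhds_zero_nat.comp hφ.tendsto_atTop
  have hlim₁ : Filter.Tendsto (fun k => (z (φ k)).1) Filter.atTop (nhds q') :=
    (continuous_fst.tendsto _).comp hlim
  have hlim₂ : Filter.Tendsto (fun k => (z (φ k)).2) Filter.atTop (nhds h) :=
    (continuous_snd.tendsto _).comp hlim
  have hq' : q' = q := by
    refine tendsto_nhds_unique hlim₁ (tendsto_pi_nhds.2 fun v => ?_)
    rw [tendsto_iff_dist_tendsto_zero]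
    exact squeeze_zero (fun _ => dist_nonneg) (fun k => hzq (φ k) v) hε
  subst hq'
  have hlim := (hlim₂.const_sub (condEntTwo q')).sub
    (hε.mul_const (Real.log (Fintype.card (𝒳₁ × 𝒳₂ × 𝒴₁ × 𝒴₂)) + 1))
  rw [zero_mul, sub_zero] at hlim
  exact ⟨h, hmem, le_of_tendsto' hlim fun k => hzR (φ k)⟩

/-- Theorem 1 of the paper, converse for one round. If `(R12, 0)` is
admissible for `q` with one round of communication, then there is a finite auxiliary
alphabet `𝒰` with `|𝒰| ≤ |𝒳¹||𝒴¹||𝒳²||𝒴²| + 1` and a pmf `p(u,x¹,x²,y¹,y²)` whose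
`(x¹,x²,y¹,y²)`-marginal is `q`, satisfying the Markov chains `U – X¹ – X²`,
`Y¹ – (U,X¹) – (X²,Y²)` and `Y² – (U,X²) – (X¹,Y¹)`, such that
`R12 ≥ I_p(U; X¹,Y¹,Y² | X²)`.
Coordinates on `𝒰 × 𝒳₁ × 𝒳₂ × 𝒴₁ × 𝒴₂`: `a.1 = u`, `a.2.1 = x¹`, `a.2.2.1 = x²`,
`a.2.2.2.1 = y¹`, `a.2.2.2.2 = y²`. -/
theorem one_round_converse
    [Fintype 𝒳₁] [DecidableEq 𝒳₁] [Fintype 𝒳₂] [DecidableEq 𝒳₂]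
    [Fintype 𝒴₁] [DecidableEq 𝒴₁] [Fintype 𝒴₂] [DecidableEq 𝒴₂]
    (q : 𝒳₁ × 𝒳₂ × 𝒴₁ × 𝒴₂ → ℝ) (hq : IsPMF q) (R12 : ℝ)
    (hadm : Admissible q 1 R12 0) :
    ∃ (𝒰 : Type) (_ : Fintype 𝒰) (_ : DecidableEq 𝒰)
      (p : 𝒰 × 𝒳₁ × 𝒳₂ × 𝒴₁ × 𝒴₂ → ℝ),
      IsPMF p ∧
      -- the (x¹,x²,y¹,y²)-marginal of p is q
      (∀ x₁ x₂ y₁ y₂, (∑ u, p (u, x₁, x₂, y₁, y₂)) = q (x₁, x₂, y₁, y₂)) ∧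
      -- U – X¹ – X²
      cmi p (fun a => a.1) (fun a => a.2.2.1) (fun a => a.2.1) = 0 ∧
      -- Y¹ – (U, X¹) – (X², Y²)
      cmi p (fun a => a.2.2.2.1) (fun a => (a.2.2.1, a.2.2.2.2))
        (fun a => (a.1, a.2.1)) = 0 ∧
      -- Y² – (U, X²) – (X¹, Y¹)
      cmi p (fun a => a.2.2.2.2) (fun a => (a.2.1, a.2.2.2.1))
        (fun a => (a.1, a.2.2.1)) = 0 ∧
      -- cardinality bound
      Fintype.card 𝒰 ≤
        Fintype.card 𝒳₁ * Fintype.card 𝒴₁ * Fintype.card 𝒳₂ * Fintype.card 𝒴₂ + 1 ∧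
      -- rate bound: R12 ≥ I(U; X¹, Y¹, Y² | X²)
      R12 ≥ cmi p (fun a => a.1) (fun a => (a.2.1, a.2.2.2.1, a.2.2.2.2))
        (fun a => a.2.2.1) := by
  obtain ⟨h, hmem, hR⟩ := exists_mem_convexHull_le_rate hq hadm
  obtain ⟨𝒰, _, _, p, hp, hmarg, h1, h2, h3, hcard, hrate⟩ :=
    exists_auxiliary_of_mem_convexHull q hmem
  refine ⟨𝒰, inferInstance, inferInstance, p, hp, hmarg, h1, h2, h3, hcard, ?_⟩
  rw [hrate, ge_iff_le, div_le_iff₀ (Real.log_pos one_lt_two)]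
  exact hR

end Coord
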